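/- arXiv:2102.01126 — 3 statements merged into one kernel-verified Lean document; each statement's English description precedes it below -/
import Mathlib

section
/- Let λ1, λ2, μ, α > 0 and λ = λ1 + λ2. Define the row vector π̄ = (1/((λ+μ)(λ+α))) · [αμ, αλ(α+λ+μ)/(α+μ), μλ, μλ²/(α+μ)], the diagonal matrix D = diag(λ, λ1+μ, λ+α, λ1+μ+α), and the matrix Q with rows (0, λ, 0, 0), (0, λ1, μ, 0), (α, 0, 0, λ), (0, α, μ, λ1). Then π̄ D = π̄ Q (componentwise in each of the four coordinates). -/
open Matrix

/-- The stationary probability vector of the blocking-policy SHS Markov chain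
satisfies π̄ D = π̄ Q, where D is the diagonal matrix of total outgoing rates
and Q is the matrix of transition rates. -/
theorem blocking_stationary_vector_equation
    (l1 l2 μ α : ℝ) (hl1 : 0 < l1) (hl2 : 0 < l2) (hμ : 0 < μ) (hα : 0 < α) :
    let lam := l1 + l2
    let π : Fin 4 → ℝ := fun i =>
      (1 / ((lam + μ) * (lam + α))) *
        ![α * μ, α * lam * (α + lam + μ) / (α + μ), μ * lam, μ * lam ^ 2 / (α + μ)] i
    let D : Matrix (Fin 4) (Fin 4) ℝ :=
      Matrix.diagonal ![lam, l1 + μ, lam + α, l1 + μ + α]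
    let Q : Matrix (Fin 4) (Fin 4) ℝ :=
      !![0, lam, 0, 0;
         0, l1, μ, 0;
         α, 0, 0, lam;
         0, α, μ, l1]
    π ᵥ* D = π ᵥ* Q := by
  intro lam π D Q
  have hαμ : α + μ ≠ 0 := by positivity
  have hlμ : l1 + l2 + μ ≠ 0 := by positivity
  have hlα : l1 + l2 + α ≠ 0 := by positivity
  ext i
  fin_cases i <;>
    simp [π, D, Q, lam, vecMul, dotProduct, Fin.sum_univ_four] <;>
    field_simp <;> ring
end

section
/- Let λ1 > 0, μ > 0, α > 0, and set ρ1 = λ1/μ, ᾱ = α/μ. Define, for real s with s̄ = s/μ, ψ1(s̄) = ρ1 s̄ − ρ1 + s̄(1−s̄), ψ2(s̄) = ρ1²(s̄−1) + ρ1(−1+4s̄−3s̄²) + s̄(1−3s̄+2s̄²), Ψ(s̄) = s̄(1−s̄)(ρ1−s̄)(ρ1+1−s̄) + ᾱ²ψ1(s̄) + ᾱψ2(s̄), and M1(s) = ρ1ᾱ(s̄−ᾱ−ρ1−1)/Ψ(s̄). Then M1 is differentiable at s = 0 and its derivative at s = 0 equals 1/λ1 + 1/μ + 1/α. -/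
/-- In the single-source case (λ2 = 0), the preemptive-policy MGF is differentiable
at s = 0 with derivative (average AoI) 1/λ1 + 1/μ + 1/α. -/
theorem preemptive_average_aoi_single_source
    (l1 μ α : ℝ) (hl1 : 0 < l1) (hμ : 0 < μ) (hα : 0 < α) :
    let ρ1 := l1 / μ
    let a := α / μ
    let ψ1 : ℝ → ℝ := fun t => ρ1 * t - ρ1 + t * (1 - t)
    let ψ2 : ℝ → ℝ := fun t => ρ1 ^ 2 * (t - 1) + ρ1 * (-1 + 4 * t - 3 * t ^ 2)
      + t * (1 - 3 * t + 2 * t ^ 2)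
    let Ψ : ℝ → ℝ := fun t => t * (1 - t) * (ρ1 - t) * (ρ1 + 1 - t)
      + a ^ 2 * ψ1 t + a * ψ2 t
    let M1 : ℝ → ℝ := fun s => ρ1 * a * (s / μ - a - ρ1 - 1) / Ψ (s / μ)
    HasDerivAt M1 (1 / l1 + 1 / μ + 1 / α) 0 := by
  intro ρ1 a ψ1 ψ2 Ψ M1
  have hρ : 0 < ρ1 := div_pos hl1 hμ
  have ha : 0 < a := div_pos hα hμ
  have hΨ (t : ℝ) : Ψ t = -((a + ρ1 + 1 - t) * ((ρ1 - t) * (1 - t) * (a - t))) := by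
    simp only [Ψ, ψ1, ψ2]
    ring
  have hM : M1 = fun s => ρ1 * a * (s / μ - a - ρ1 - 1) /
      -((a + ρ1 + 1 - s / μ) * ((ρ1 - s / μ) * (1 - s / μ) * (a - s / μ))) := by
    funext s
    simp only [M1, hΨ]
  have hid : HasDerivAt (fun s : ℝ => s / μ) (1 / μ) 0 := (hasDerivAt_id 0).div_const μ
  have hnum := (((hid.sub_const a).sub_const ρ1).sub_const 1).const_mul (ρ1 * a)
  have hden := ((hid.const_sub (a + ρ1 + 1)).mul
    (((hid.const_sub ρ1).mul (hid.const_sub 1)).mul (hid.const_sub a))).neg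
  have hsum : a + ρ1 + 1 ≠ 0 := by positivity
  rw [hM]
  refine (hnum.div hden ?_).congr_deriv ?_
  · simp [hsum, hρ.ne', ha.ne']
  · have hl : l1 = ρ1 * μ := (div_mul_cancel₀ l1 hμ.ne').symm
    have hα' : α = a * μ := (div_mul_cancel₀ α hμ.ne').symm
    rw [hl, hα']
    clear_value ρ1 a
    simp only [Pi.neg_apply, Pi.mul_apply, zero_div, sub_zero]
    field_simp
    ring
end

section
/- Let λ1 > 0, λ2 ≥ 0, μ > 0 with ρ1 = λ1/μ, ρ2 = λ2/μ, ρ = ρ1 + ρ2. For each α > 0 define ᾱ = α/μ and let Δ1(α) be the derivative at s = 0 of the function s ↦ ρ1ᾱ(s/μ − ᾱ − ρ − 1)/Ψ(s/μ), where Ψ(s̄) = s̄(1−s̄)(ρ−s̄)(ρ+1−s̄) + ᾱ²(ρ s̄ − ρ1 + s̄(1−s̄)) + ᾱ(ρ1²(s̄−1) + ρ1ρ2(2s̄−1) + ρ1(−1+4s̄−3s̄²) + ρ2 s̄(ρ2+2−3s̄) + s̄(1−3s̄+2s̄²)). Then Δ1(α) converges to (1+ρ)/(μ ρ1) as α → ∞.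 -/
open Filter

/-- As α → ∞, the average AoI of source 1 under the preemptive policy (the derivative
of the MGF at s = 0) tends to (1+ρ)/(μρ1), the LCFS-S average AoI. -/
theorem preemptive_average_aoi_alpha_limit
    (l1 l2 μ : ℝ) (hl1 : 0 < l1) (hl2 : 0 ≤ l2) (hμ : 0 < μ) :
    let ρ1 := l1 / μ
    let ρ2 := l2 / μ
    let ρ := ρ1 + ρ2
    let Ψ : ℝ → ℝ → ℝ := fun a t =>
      t * (1 - t) * (ρ - t) * (ρ + 1 - t)
      + a ^ 2 * (ρ * t - ρ1 + t * (1 - t))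
      + a * (ρ1 ^ 2 * (t - 1) + ρ1 * ρ2 * (2 * t - 1) + ρ1 * (-1 + 4 * t - 3 * t ^ 2)
          + ρ2 * t * (ρ2 + 2 - 3 * t) + t * (1 - 3 * t + 2 * t ^ 2))
    let Δ1 : ℝ → ℝ := fun α =>
      deriv (fun s => ρ1 * (α / μ) * (s / μ - α / μ - ρ - 1) / Ψ (α / μ) (s / μ)) 0
    Tendsto Δ1 atTop (nhds ((1 + ρ) / (μ * ρ1))) := by
  intro ρ1 ρ2 ρ Ψ Δ1
  have hρ1 : 0 < ρ1 := div_pos hl1 hμ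
  have hρ2 : 0 ≤ ρ2 := div_nonneg hl2 hμ.le
  have hρ : 0 < ρ := add_pos_of_pos_of_nonneg hρ1 hρ2
  let K : ℝ := ρ1 ^ 2 + 2 * (ρ1 * ρ2) + 4 * ρ1 + ρ2 ^ 2 + 2 * ρ2 + 1
  let D : ℝ → ℝ := fun a => ρ * (ρ + 1) + a ^ 2 * (ρ + 1) + a * K
  have hΨ0 (a : ℝ) : Ψ a 0 = -(a * ρ1 * (a + ρ + 1)) := by
    simp only [Ψ, ρ]
    ring
  have hΨ (a : ℝ) : HasDerivAt (Ψ a) (D a) 0 := by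
    let E : ℝ → ℝ := fun t => -(2 * ρ + 1) + t * (1 - t) - ρ * (ρ + 1) + (2 * ρ + 1) * t
      - a ^ 2 - a * (3 * ρ1 + 3 * ρ2 + 3 - 2 * t)
    have hE : HasDerivAt (fun t => t ^ 2 * E t) 0 0 := by
      have hEd : DifferentiableAt ℝ E 0 := by fun_prop
      simpa using (hasDerivAt_pow 2 (0 : ℝ)).fun_mul hEd.hasDerivAt
    have hlin := ((hasDerivAt_id (0 : ℝ)).const_mul (D a)).const_add (Ψ a 0)
    refine ((hlin.add hE).congr_deriv (by simp)).congr_of_eventuallyEq (.of_forall fun t => ?_)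
    simp only [Pi.add_apply, id, hΨ0, Ψ, D, E, K, ρ]
    ring
  have hΔ (α : ℝ) (hα : 0 < α) :
      Δ1 α = (D (α / μ) - ρ1 * (α / μ)) / (μ * ((α / μ) * ρ1 * (α / μ + ρ + 1))) := by
    have ha : 0 < α / μ := div_pos hα hμ
    have hs : HasDerivAt (fun s : ℝ => s / μ) (1 / μ) 0 := (hasDerivAt_id 0).div_const μ
    have hnum := (((hs.sub_const (α / μ)).sub_const ρ).sub_const 1).const_mul (ρ1 * (α / μ))
    have hden : HasDerivAt (fun s : ℝ => Ψ (α / μ) (s / μ)) (D (α / μ) * (1 / μ)) 0 :=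
      HasDerivAt.comp (h₂ := Ψ (α / μ)) (0 : ℝ) (by simpa using hΨ (α / μ)) hs
    have hne : 0 < (α / μ) * ρ1 * (α / μ + ρ + 1) := by positivity
    refine (hnum.fun_div hden
      (by simp only [zero_div, hΨ0]; exact neg_ne_zero.2 hne.ne')).deriv.trans ?_
    simp only [zero_div, hΨ0]
    generalize α / μ = a at *
    generalize D a = d
    have h1 : a + ρ + 1 ≠ 0 := by positivity
    clear_value ρ ρ1
    field_simp
    ring
  have hx : Tendsto (fun α : ℝ => (α / μ)⁻¹) atTop (nhds 0) :=
    (tendsto_id.atTop_div_const hμ).inv_tendsto_atTop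
  let F : ℝ → ℝ := fun x =>
    ((ρ + 1) + x * (K - ρ1) + x ^ 2 * (ρ * (ρ + 1))) / (μ * ρ1 * (1 + (ρ + 1) * x))
  have hF : ContinuousAt F 0 := by
    refine ContinuousAt.div (by fun_prop) (by fun_prop) ?_
    simp only [mul_zero, add_zero, mul_one]
    positivity
  have hF0 : F 0 = (1 + ρ) / (μ * ρ1) := by simp [F, add_comm]
  rw [← hF0]
  refine (hF.tendsto.comp hx).congr' ?_
  filter_upwards [eventually_gt_atTop 0] with α hα
  rw [hΔ α hα]
  have ha : 0 < α / μ := div_pos hα hμ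
  simp only [Function.comp, F, D]
  generalize α / μ = a at *
  have h1 : a + ρ + 1 ≠ 0 := by positivity
  have h2 : 1 + (ρ + 1) * a⁻¹ ≠ 0 := by positivity
  clear_value K ρ ρ1
  rw [div_eq_div_iff (by positivity) (by positivity)]
  field_simp
  ring
end
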